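/- If φ ∈ 𝒮(ℝ) and c_j := ∫_ℝ φ(x) e_j(x) dx denote its Hermite coefficients (j ≥ 1), then for every k ∈ ℕ one has Σ_{j=1}^∞ c_j² (2j)^k < ∞. -/

import Mathlib

open MeasureTheory

noncomputable section

/-- The `n`-th probabilists' Hermite polynomial
`hₙ(x) = (−1)ⁿ e^{x²/2} (dⁿ/dxⁿ) e^{−x²/2}`. -/
def hermiteP (n : ℕ) (x : ℝ) : ℝ :=
  (-1 : ℝ)^n * Real.exp (x^2 / 2) * iteratedDeriv n (fun y => Real.exp (-(y^2) / 2)) x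

/-- The `k`-th Hermite function (`k ≥ 1`):
`e_k(x) = π^{−1/4} ((k−1)!)^{−1/2} e^{−x²/2} h_{k−1}(√2 x)`. -/
def hermiteFun (k : ℕ) (x : ℝ) : ℝ :=
  Real.pi ^ (-(1/4) : ℝ) * ((Nat.factorial (k - 1) : ℝ)) ^ (-(1/2) : ℝ) *
    Real.exp (-(x^2) / 2) * hermiteP (k - 1) (Real.sqrt 2 * x)

open Polynomial SchwartzMap

theorem iteratedDeriv_exp_neg_sq_div_two (n : ℕ) (x : ℝ) :
    iteratedDeriv n (fun y : ℝ => Real.exp (-(y ^ 2) / 2)) x =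
      (-1) ^ n * aeval x (hermite n) * Real.exp (-(x ^ 2) / 2) := by
  simp only [neg_div, iteratedDeriv_eq_iterate]
  exact deriv_gaussian_eq_hermite_mul_gaussian n x

theorem hermiteP_eq_aeval_hermite (n : ℕ) (x : ℝ) : hermiteP n x = aeval x (hermite n) := by
  have h : Real.exp (x ^ 2 / 2) * Real.exp (-(x ^ 2) / 2) = 1 := by
    rw [← Real.exp_add]; simp [neg_div]
  have h' : ((-1 : ℝ) ^ n) * (-1) ^ n = 1 := by rw [← mul_pow]; simp
  rw [hermiteP, iteratedDeriv_exp_neg_sq_div_two]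
  linear_combination (aeval x (hermite n)) * h' * (Real.exp (x ^ 2 / 2) * Real.exp (-(x ^ 2) / 2)) +
    (aeval x (hermite n)) * h

theorem exists_abs_pow_mul_exp_neg_sq_le (m : ℕ) :
    ∃ C : ℝ, ∀ x : ℝ, |x| ^ m * Real.exp (-(x ^ 2) / 2) ≤ C := by
  refine ⟨m.factorial * Real.exp (1 / 2), fun x => ?_⟩
  have h1 : |x| ^ m ≤ m.factorial * Real.exp |x| := by
    have := Real.pow_div_factorial_le_exp |x| (abs_nonneg x) m
    rwa [div_le_iff₀' (by positivity)] at this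
  calc |x| ^ m * Real.exp (-(x ^ 2) / 2)
      ≤ m.factorial * Real.exp |x| * Real.exp (-(x ^ 2) / 2) := by gcongr
    _ = m.factorial * Real.exp (|x| + -(x ^ 2) / 2) := by rw [mul_assoc, Real.exp_add]
    _ ≤ m.factorial * Real.exp (1 / 2) := by
      gcongr
      nlinarith [sq_nonneg (|x| - 1), sq_abs x]

theorem exists_abs_pow_mul_aeval_mul_exp_neg_sq_le (k : ℕ) (p : ℤ[X]) :
    ∃ C : ℝ, ∀ x : ℝ, |x| ^ k * |aeval x p * Real.exp (-(x ^ 2) / 2)| ≤ C := by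
  induction p using Polynomial.induction_on' with
  | add p q hp hq =>
    obtain ⟨C, hC⟩ := hp
    obtain ⟨D, hD⟩ := hq
    refine ⟨C + D, fun x => le_trans ?_ (add_le_add (hC x) (hD x))⟩
    rw [map_add, add_mul, ← mul_add]
    gcongr
    exact abs_add_le _ _
  | monomial m a =>
    obtain ⟨C, hC⟩ := exists_abs_pow_mul_exp_neg_sq_le (k + m)
    refine ⟨|(a : ℝ)| * C, fun x => ?_⟩
    have h := mul_le_mul_of_nonneg_left (hC x) (abs_nonneg (a : ℝ))
    rw [aeval_monomial, abs_mul, abs_mul, abs_pow, Real.abs_exp]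
    simp only [algebraMap_int_eq, eq_intCast]
    calc _ = |(a : ℝ)| * (|x| ^ (k + m) * Real.exp (-(x ^ 2) / 2)) := by ring
      _ ≤ _ := h

/-- The Gaussian `e^{−x²/2}` as a Schwartz function. -/
def gaussianSchwartz : SchwartzMap ℝ ℝ where
  toFun x := Real.exp (-(x ^ 2) / 2)
  smooth' := by fun_prop
  decay' k n := by
    obtain ⟨C, hC⟩ := exists_abs_pow_mul_aeval_mul_exp_neg_sq_le k (hermite n)
    refine ⟨C, fun x => ?_⟩
    rw [norm_iteratedFDeriv_eq_norm_iteratedDeriv, iteratedDeriv_exp_neg_sq_div_two, mul_assoc,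
      norm_mul, norm_pow, norm_neg, norm_one, one_pow, one_mul]
    exact hC x

theorem gaussianSchwartz_apply (x : ℝ) : gaussianSchwartz x = Real.exp (-(x ^ 2) / 2) := rfl

/-- The raising operator `f ↦ x f − f'`. -/
def hermiteRaise : SchwartzMap ℝ ℝ →L[ℝ] SchwartzMap ℝ ℝ :=
  smulLeftCLM ℝ (id : ℝ → ℝ) - derivCLM ℝ ℝ

/-- The lowering operator `f ↦ x f + f'`. -/
def hermiteLower : SchwartzMap ℝ ℝ →L[ℝ] SchwartzMap ℝ ℝ :=
  smulLeftCLM ℝ (id : ℝ → ℝ) + derivCLM ℝ ℝ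

theorem hermiteRaise_apply (f : SchwartzMap ℝ ℝ) (x : ℝ) :
    hermiteRaise f x = x * f x - deriv f x := by
  simp [hermiteRaise, smulLeftCLM_apply_apply Function.HasTemperateGrowth.id]

theorem hermiteLower_apply (f : SchwartzMap ℝ ℝ) (x : ℝ) :
    hermiteLower f x = x * f x + deriv f x := by
  simp [hermiteLower, smulLeftCLM_apply_apply Function.HasTemperateGrowth.id]

theorem hermiteLower_hermiteRaise (f : SchwartzMap ℝ ℝ) :
    hermiteLower (hermiteRaise f) = hermiteRaise (hermiteLower f) + (2 : ℝ) • f := by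
  ext x
  have hx : HasDerivAt (fun y => y * f y) (1 * f x + x * deriv f x) x :=
    (hasDerivAt_id x).mul (f.hasDerivAt x)
  have hd : HasDerivAt (deriv f) (deriv (deriv f) x) x := (derivCLM ℝ ℝ f).hasDerivAt x
  have h1 : deriv (hermiteRaise f) x = 1 * f x + x * deriv f x - deriv (deriv f) x := by
    rw [funext (hermiteRaise_apply f)]
    exact (hx.sub hd).deriv
  have h2 : deriv (hermiteLower f) x = 1 * f x + x * deriv f x + deriv (deriv f) x := by
    rw [funext (hermiteLower_apply f)]
    exact (hx.add hd).deriv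
  rw [add_apply, smul_apply, hermiteLower_apply, hermiteRaise_apply (hermiteLower f), h1, h2,
    hermiteRaise_apply, hermiteLower_apply, smul_eq_mul]
  ring

theorem SchwartzMap.integrable_mul (f g : SchwartzMap ℝ ℝ) : Integrable (fun x => f x * g x) :=
  (pairing (ContinuousLinearMap.mul ℝ ℝ) f g).integrable (μ := volume)

theorem integral_mul_hermiteRaise (f g : SchwartzMap ℝ ℝ) :
    ∫ x, f x * hermiteRaise g x = ∫ x, hermiteLower f x * g x := by
  have hx : Integrable fun x => x * f x * g x := by
    simpa [smulLeftCLM_apply_apply Function.HasTemperateGrowth.id] using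
      (smulLeftCLM ℝ (id : ℝ → ℝ) f).integrable_mul g
  have h1 : Integrable fun x => f x * deriv g x := f.integrable_mul (derivCLM ℝ ℝ g)
  have h2 : Integrable fun x => deriv f x * g x := (derivCLM ℝ ℝ f).integrable_mul g
  have e1 : ∀ x, f x * hermiteRaise g x = x * f x * g x - f x * deriv g x := fun x => by
    rw [hermiteRaise_apply]; ring
  have e2 : ∀ x, hermiteLower f x * g x = x * f x * g x + deriv f x * g x := fun x => by
    rw [hermiteLower_apply]; ring
  simp_rw [e1, e2]
  rw [integral_sub hx h1, integral_add hx h2, integral_mul_deriv_eq_neg_deriv_mul, sub_neg_eq_add]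

/-- The Schwartz function underlying `hermiteFun (n + 1)`, built with the raising operator. -/
def hermiteSchwartz : ℕ → SchwartzMap ℝ ℝ
  | 0 => (Real.pi ^ (-(1 / 4) : ℝ)) • gaussianSchwartz
  | n + 1 => (√(2 * (n + 1 : ℝ)))⁻¹ • hermiteRaise (hermiteSchwartz n)

theorem hermiteRaise_hermiteSchwartz (n : ℕ) :
    hermiteRaise (hermiteSchwartz n) = √(2 * (n + 1 : ℝ)) • hermiteSchwartz (n + 1) := by
  rw [hermiteSchwartz, smul_inv_smul₀ (by positivity)]

theorem hermiteLower_hermiteSchwartz_zero : hermiteLower (hermiteSchwartz 0) = 0 := by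
  have h : hermiteLower gaussianSchwartz = 0 := by
    ext x
    have hd : HasDerivAt gaussianSchwartz (Real.exp (-(x ^ 2) / 2) * (-(2 * x) / 2)) x := by
      simpa using! (((hasDerivAt_pow 2 x).neg).div_const 2).exp
    rw [hermiteLower_apply, hd.deriv, gaussianSchwartz_apply, zero_apply]
    ring
  rw [hermiteSchwartz, map_smul, h, smul_zero]

theorem hermiteLower_hermiteSchwartz_succ (n : ℕ) :
    hermiteLower (hermiteSchwartz (n + 1)) = √(2 * (n + 1 : ℝ)) • hermiteSchwartz n := by
  have key : hermiteRaise (hermiteLower (hermiteSchwartz n)) = (2 * n : ℝ) • hermiteSchwartz n := by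
    induction n with
    | zero => simp [hermiteLower_hermiteSchwartz_zero]
    | succ n ih =>
      rw [hermiteSchwartz, map_smul, hermiteLower_hermiteRaise, ih, ← add_smul, map_smul, map_smul,
        smul_comm]
      push_cast
      congr 1
      ring_nf
  have hs : √(2 * (n + 1 : ℝ)) ≠ 0 := by positivity
  have hs' : √(2 * (n + 1 : ℝ)) * √(2 * (n + 1 : ℝ)) = 2 * (n + 1) :=
    Real.mul_self_sqrt (by positivity)
  rw [hermiteSchwartz, map_smul, hermiteLower_hermiteRaise, key, ← add_smul, smul_smul]
  congr 1
  field_simp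
  linear_combination -hs'

theorem integral_mul_hermiteSchwartz_succ (f : SchwartzMap ℝ ℝ) (n : ℕ) :
    ∫ x, f x * hermiteSchwartz (n + 1) x =
      (√(2 * (n + 1 : ℝ)))⁻¹ * ∫ x, hermiteLower f x * hermiteSchwartz n x := by
  rw [← integral_mul_hermiteRaise, ← integral_const_mul]
  simp only [hermiteSchwartz, smul_apply, smul_eq_mul]
  exact integral_congr_ae (.of_forall fun x => by ring)

theorem integral_hermiteSchwartz_mul_self (n : ℕ) :
    ∫ x, hermiteSchwartz n x * hermiteSchwartz n x =
      ∫ x, hermiteSchwartz 0 x * hermiteSchwartz 0 x := by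
  induction n with
  | zero => rfl
  | succ n ih =>
    have hs : √(2 * (n + 1 : ℝ)) ≠ 0 := by positivity
    rw [integral_mul_hermiteSchwartz_succ, hermiteLower_hermiteSchwartz_succ, ← ih]
    simp only [smul_apply, smul_eq_mul, mul_assoc]
    rw [integral_const_mul, inv_mul_cancel_left₀ hs]

theorem exists_sq_integral_mul_hermiteSchwartz_le (f : SchwartzMap ℝ ℝ) :
    ∃ C : ℝ, ∀ n, (∫ x, f x * hermiteSchwartz n x) ^ 2 ≤ C := by
  set D := (∫ x, f x * f x) + ∫ x, hermiteSchwartz 0 x * hermiteSchwartz 0 x with hD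
  refine ⟨D ^ 2, fun n => ?_⟩
  have hi := (f.integrable_mul f).add ((hermiteSchwartz n).integrable_mul (hermiteSchwartz n))
  have h : ‖∫ x, f x * hermiteSchwartz n x‖ ≤ D := by
    rw [hD, ← integral_hermiteSchwartz_mul_self n, ← integral_add (f.integrable_mul f)
      ((hermiteSchwartz n).integrable_mul _)]
    refine norm_integral_le_of_norm_le hi (.of_forall fun x => ?_)
    rw [Real.norm_eq_abs, abs_le]
    constructor <;>
      nlinarith [sq_nonneg (f x + hermiteSchwartz n x), sq_nonneg (f x - hermiteSchwartz n x),
        sq_nonneg (f x), sq_nonneg (hermiteSchwartz n x)]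
  exact sq_le_sq.2 (h.trans (le_abs_self D))

theorem exists_sq_integral_mul_hermiteSchwartz_mul_pow_le (k : ℕ) (f : SchwartzMap ℝ ℝ) :
    ∃ C : ℝ, ∀ n : ℕ, (∫ x, f x * hermiteSchwartz n x) ^ 2 * (2 * (n + 1 : ℝ)) ^ k ≤ C := by
  induction k generalizing f with
  | zero => simpa using exists_sq_integral_mul_hermiteSchwartz_le f
  | succ k ih =>
    obtain ⟨C, hC⟩ := ih (hermiteLower f)
    refine ⟨max ((∫ x, f x * hermiteSchwartz 0 x) ^ 2 * 2 ^ (k + 1)) (2 ^ (k + 1) * C), fun n => ?_⟩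
    cases n with
    | zero => exact le_max_of_le_left (by simp)
    | succ m =>
      refine le_max_of_le_right ?_
      have hm : 2 * (((m + 1 : ℕ) : ℝ) + 1) ≤ 2 * (2 * (m + 1 : ℝ)) := by
        push_cast
        linarith [m.cast_nonneg (α := ℝ)]
      rw [integral_mul_hermiteSchwartz_succ, mul_pow, inv_pow, Real.sq_sqrt (by positivity)]
      set I := ∫ x, hermiteLower f x * hermiteSchwartz m x
      calc (2 * (m + 1 : ℝ))⁻¹ * I ^ 2 * (2 * (((m + 1 : ℕ) : ℝ) + 1)) ^ (k + 1)
          ≤ (2 * (m + 1 : ℝ))⁻¹ * I ^ 2 * (2 * (2 * (m + 1 : ℝ))) ^ (k + 1) := by gcongr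
        _ = 2 ^ (k + 1) * (I ^ 2 * (2 * (m + 1 : ℝ)) ^ k) := by
          rw [mul_pow 2 (2 * (m + 1 : ℝ)), pow_succ (2 * (m + 1 : ℝ)) k]
          field_simp
        _ ≤ 2 ^ (k + 1) * C := by gcongr; exact hC m

theorem hermiteFun_succ_eq (n : ℕ) (x : ℝ) :
    hermiteFun (n + 1) x = Real.pi ^ (-(1 / 4) : ℝ) * (√(n.factorial : ℝ))⁻¹ *
      Real.exp (-(x ^ 2) / 2) * aeval (√2 * x) (hermite n) := by
  rw [hermiteFun, hermiteP_eq_aeval_hermite, Nat.add_sub_cancel,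
    Real.rpow_neg (Nat.cast_nonneg _), ← Real.sqrt_eq_rpow]

theorem hasDerivAt_hermiteFun_succ (n : ℕ) (x : ℝ) :
    HasDerivAt (hermiteFun (n + 1))
      (x * hermiteFun (n + 1) x - √(2 * (n + 1 : ℝ)) * hermiteFun (n + 2) x) x := by
  have hg : HasDerivAt (fun y : ℝ => Real.exp (-(y ^ 2) / 2))
      (Real.exp (-(x ^ 2) / 2) * (-(2 * x) / 2)) x := by
    simpa using! (((hasDerivAt_pow 2 x).neg).div_const 2).exp
  have hp : HasDerivAt (fun y : ℝ => aeval (√2 * y) (hermite n))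
      (aeval (√2 * x) (derivative (hermite n)) * √2) x := by
    have hl : HasDerivAt (fun y : ℝ => √2 * y) √2 x := by
      simpa using (hasDerivAt_id x).const_mul √2
    exact ((hermite n).hasDerivAt_aeval (√2 * x)).comp x hl
  rw [funext (hermiteFun_succ_eq n)]
  convert! (hg.const_mul (Real.pi ^ (-(1 / 4) : ℝ) * (√(n.factorial : ℝ))⁻¹)).mul hp using 1
  have h2 : √2 * √2 = (2 : ℝ) := Real.mul_self_sqrt (by norm_num)
  have hn : √(n + 1 : ℝ) ≠ 0 := by positivity
  have hf : √(n.factorial : ℝ) ≠ 0 := by positivity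
  rw [hermiteFun_succ_eq (n + 1), hermite_succ, Nat.factorial_succ, Nat.cast_mul, Nat.cast_succ,
    Real.sqrt_mul (by positivity), Real.sqrt_mul (by positivity), map_sub, map_mul, aeval_X]
  beta_reduce
  generalize aeval (√2 * x) (hermite n) = u
  field_simp
  linear_combination (-x * u) * h2

theorem hermiteSchwartz_apply (n : ℕ) (x : ℝ) : hermiteSchwartz n x = hermiteFun (n + 1) x := by
  induction n generalizing x with
  | zero => simp [hermiteFun_succ_eq, hermiteSchwartz, gaussianSchwartz_apply]
  | succ n ih =>
    have hs : √(2 * (n + 1 : ℝ)) ≠ 0 := by positivity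
    rw [hermiteSchwartz, smul_apply, hermiteRaise_apply, funext ih,
      (hasDerivAt_hermiteFun_succ n x).deriv, sub_sub_cancel, smul_eq_mul,
      inv_mul_cancel_left₀ hs]

/-- If `φ ∈ 𝒮(ℝ)` and `c_j = ∫ φ(x) e_j(x) dx` are its Hermite coefficients (`j ≥ 1`),
then `Σ_{j=1}^∞ c_j² (2j)^k < ∞` for every `k ∈ ℕ`. -/
theorem schwartz_hermite_coeff_decay (φ : SchwartzMap ℝ ℝ) (k : ℕ) :
    Summable (fun j : ℕ =>
      (∫ x, φ x * hermiteFun (j + 1) x)^2 * ((2 * (j + 1) : ℕ) : ℝ)^k) := by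
  obtain ⟨C, hC⟩ := exists_sq_integral_mul_hermiteSchwartz_mul_pow_le (k + 2) φ
  have hs : Summable fun j : ℕ => C * (1 / ((j + 1 : ℕ) : ℝ) ^ 2) :=
    ((summable_nat_add_iff 1).2 (Real.summable_one_div_nat_pow.2 one_lt_two)).mul_left C
  refine hs.of_nonneg_of_le (fun j => by positivity) fun j => ?_
  have h := hC j
  simp only [hermiteSchwartz_apply] at h
  rw [mul_one_div, le_div_iff₀ (by positivity)]
  refine le_trans ?_ h
  push_cast
  rw [pow_add, ← mul_assoc]
  gcongr
  linarith [j.cast_nonneg (α := ℝ)]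

end
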